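/- For every n ∈ ℕ and all A, B ∈ ℤ*: if A ~ B then (0^{2n}, A) ~ (0^{2n}, B), where 0^{2n} denotes 2n copies of 0 prepended to the sequence. -/

import Mathlib

/-- `Y` is a blowing-up of the finite integer sequence `X`. -/
inductive SeqBlowup : List ℤ → List ℤ → Prop
  | empty : SeqBlowup [] [-1]
  | left (x : ℤ) (l : List ℤ) : SeqBlowup (x :: l) (-1 :: (x - 1) :: l)
  | mid (A B : List ℤ) (a b : ℤ) :
      SeqBlowup (A ++ a :: b :: B) (A ++ (a - 1) :: -1 :: (b - 1) :: B)
  | right (l : List ℤ) (x : ℤ) : SeqBlowup (l ++ [x]) (l ++ [x - 1, -1])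

/-- Two sequences are equivalent if one is obtained from the other by a finite
sequence of blowings-up and blowings-down. -/
def SeqEquiv (X Y : List ℤ) : Prop := Relation.EqvGen SeqBlowup X Y

/-- A leading `0` allows the next entry to be increased by one. -/
theorem seqEquiv_zero_cons_add_one (b : ℤ) (l : List ℤ) :
    SeqEquiv (0 :: b :: l) (0 :: (b + 1) :: l) := by
  have h₁ : SeqBlowup (0 :: b :: l) (-1 :: -1 :: b :: l) := by
    simpa using SeqBlowup.left 0 (b :: l)
  have h₂ : SeqBlowup (0 :: (b + 1) :: l) (-1 :: -1 :: b :: l) := by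
    simpa using SeqBlowup.mid [] l 0 (b + 1)
  exact .trans _ _ _ (.rel _ _ h₁) (.symm _ _ (.rel _ _ h₂))

theorem SeqBlowup.seqEquiv_zero_zero_cons {A B : List ℤ} (h : SeqBlowup A B) :
    SeqEquiv (0 :: 0 :: A) (0 :: 0 :: B) := by
  cases h with
  | empty =>
    have h : SeqBlowup [0, 0] [0, -1, -1] := by
      simpa using SeqBlowup.right [0] 0
    exact .trans _ _ _ (.rel _ _ h) (seqEquiv_zero_cons_add_one (-1) [-1])
  | left x l =>
    have h : SeqBlowup (0 :: 0 :: x :: l) (0 :: -1 :: -1 :: (x - 1) :: l) := by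
      simpa using SeqBlowup.mid [0] l 0 x
    exact .trans _ _ _ (.rel _ _ h)
      (seqEquiv_zero_cons_add_one (-1) (-1 :: (x - 1) :: l))
  | mid A B a b => exact .rel _ _ (SeqBlowup.mid (0 :: 0 :: A) B a b)
  | right l x => exact .rel _ _ (SeqBlowup.right (0 :: 0 :: l) x)

theorem SeqEquiv.zero_zero_cons {A B : List ℤ} (h : SeqEquiv A B) :
    SeqEquiv (0 :: 0 :: A) (0 :: 0 :: B) := by
  induction h with
  | rel _ _ h => exact h.seqEquiv_zero_zero_cons
  | refl _ => exact .refl _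
  | symm _ _ _ ih => exact .symm _ _ ih
  | trans _ _ _ _ _ ih₁ ih₂ => exact .trans _ _ _ ih₁ ih₂

/-- **Lemma.** If `A ~ B` then `(0^{2n}, A) ~ (0^{2n}, B)`. -/
theorem seqEquiv_prepend_even_zeros (n : ℕ) (A B : List ℤ) (h : SeqEquiv A B) :
    SeqEquiv (List.replicate (2 * n) 0 ++ A) (List.replicate (2 * n) 0 ++ B) := by
  induction n with
  | zero => simpa using h
  | succ n ih => simpa [Nat.mul_succ, List.replicate_succ] using ih.zero_zero_cons
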